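/- For every positive integer q and every real number x that is not an integer, c_q(x) = (1 − e^{2πix}) · ∑_{d ∣ q} μ(q/d)/(e^{−2πix/d} − 1), where the sum runs over the positive divisors d of q (and each denominator is nonzero since x/d is not an integer). -/

import Mathlib

open Finset

/-- The real-variable Ramanujan sum `c_q(x) = ∑_{1 ≤ k ≤ q, gcd(k,q)=1} e^{2πikx/q}`. -/
noncomputable def cq (q : ℕ) (x : ℝ) : ℂ :=
  ∑ k ∈ (Finset.Icc 1 q).filter (fun k => Nat.gcd k q = 1),
    Complex.exp (2 * (Real.pi : ℂ) * Complex.I * (k : ℂ) * (x : ℂ) / (q : ℂ))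

/-- The Riemann zeta function of a real argument `s > 1`, as the series `∑_{n≥1} n^{-s}`. -/
noncomputable def zetaR (s : ℝ) : ℝ := ∑' n : ℕ, 1 / (n + 1 : ℝ) ^ s

/-- Grouping the fractions `k / n`, `1 ≤ k ≤ n`, by their reduced denominator. -/
lemma sum_divisors_sum_coprime {M : Type*} [AddCommMonoid M] (F : ℚ → M) {n : ℕ} (hn : 0 < n) :
    ∑ d ∈ n.divisors, ∑ k ∈ (Finset.Icc 1 d).filter (fun k => Nat.gcd k d = 1), F (k / d) =
      ∑ k ∈ Finset.Icc 1 n, F (k / n) := by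
  rw [Finset.sum_sigma']
  refine Finset.sum_bij' (fun p _ => p.2 * (n / p.1))
    (fun k _ => ⟨n / Nat.gcd k n, k / Nat.gcd k n⟩) ?_ ?_ ?_ ?_ ?_
  · rintro ⟨d, k⟩ h
    simp only [mem_sigma, Nat.mem_divisors, mem_filter, mem_Icc] at h
    obtain ⟨⟨⟨e, rfl⟩, -⟩, ⟨h1, h2⟩, -⟩ := h
    have hd : 0 < d := by omega
    have he : 0 < e := Nat.pos_of_mul_pos_left hn
    simp only [mem_Icc, Nat.mul_div_cancel_left _ hd]
    exact ⟨Nat.mul_pos h1 he, Nat.mul_le_mul_right _ h2⟩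
  · intro k h
    rw [mem_Icc] at h
    have hg : 0 < Nat.gcd k n := Nat.gcd_pos_of_pos_right _ hn
    simp only [mem_sigma, Nat.mem_divisors, mem_filter, mem_Icc]
    exact ⟨⟨Nat.div_dvd_of_dvd (Nat.gcd_dvd_right k n), hn.ne'⟩,
      ⟨Nat.div_pos (Nat.gcd_le_left _ h.1) hg, Nat.div_le_div_right h.2⟩,
      Nat.coprime_div_gcd_div_gcd hg⟩
  · rintro ⟨d, k⟩ h
    simp only [mem_sigma, Nat.mem_divisors, mem_filter, mem_Icc] at h
    obtain ⟨⟨⟨e, rfl⟩, -⟩, ⟨h1, h2⟩, h3⟩ := h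
    have hd : 0 < d := by omega
    have he : 0 < e := Nat.pos_of_mul_pos_left hn
    simp [Nat.mul_div_cancel_left _ hd, Nat.gcd_mul_right, h3, Nat.mul_div_cancel _ he]
  · intro k _
    have hg : 0 < Nat.gcd k n := Nat.gcd_pos_of_pos_right _ hn
    simp only [Nat.div_div_self (Nat.gcd_dvd_right k n) hn.ne']
    exact Nat.div_mul_cancel (Nat.gcd_dvd_left k n)
  · rintro ⟨d, k⟩ h
    simp only [mem_sigma, Nat.mem_divisors, mem_filter, mem_Icc] at h
    obtain ⟨⟨⟨e, rfl⟩, -⟩, ⟨h1, h2⟩, -⟩ := h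
    have hd : 0 < d := by omega
    have he : 0 < e := Nat.pos_of_mul_pos_left hn
    have hd' : (d : ℚ) ≠ 0 := by positivity
    have he' : (e : ℚ) ≠ 0 := by positivity
    simp only [Nat.mul_div_cancel_left _ hd]
    congr 1
    push_cast
    field_simp

/-- `∑_{d ∣ n} c_d(x) = ∑_{k=1}^n e^{2πikx/n}`. -/
lemma sum_divisors_cq (x : ℝ) {n : ℕ} (hn : 0 < n) :
    ∑ d ∈ n.divisors, cq d x = ∑ k ∈ Finset.Icc 1 n,
      Complex.exp (2 * (Real.pi : ℂ) * Complex.I * (k : ℂ) * (x : ℂ) / (n : ℂ)) := by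
  have h := sum_divisors_sum_coprime
    (fun r : ℚ => Complex.exp (2 * (Real.pi : ℂ) * Complex.I * x * (r : ℂ))) hn
  have e (k d : ℕ) : 2 * (Real.pi : ℂ) * Complex.I * x * (((k : ℚ) / d : ℚ) : ℂ) =
      2 * (Real.pi : ℂ) * Complex.I * k * x / d := by
    push_cast
    ring
  simpa only [e, cq] using h

lemma geom_sum_Icc_eq_div_inv_sub_one {K : Type*} [Field K] {z : K} (h0 : z ≠ 0) (h1 : z ≠ 1)
    (n : ℕ) : ∑ k ∈ Finset.Icc 1 n, z ^ k = (1 - z ^ n) / (z⁻¹ - 1) := by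
  have h2 : z⁻¹ - 1 ≠ 0 := sub_ne_zero.mpr (by simpa using h1)
  rw [eq_div_iff h2]
  induction n with
  | zero => simp
  | succ n ih =>
    rw [Finset.sum_Icc_succ_top (by omega), add_mul, ih]
    field_simp
    ring

lemma sum_exp_eq_div (x : ℝ) (hx : ∀ m : ℤ, x ≠ m) {n : ℕ} (hn : 0 < n) :
    ∑ k ∈ Finset.Icc 1 n,
      Complex.exp (2 * (Real.pi : ℂ) * Complex.I * (k : ℂ) * (x : ℂ) / (n : ℂ)) =
      (1 - Complex.exp (2 * (Real.pi : ℂ) * Complex.I * x)) /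
        (Complex.exp (-(2 * (Real.pi : ℂ) * Complex.I * x) / n) - 1) := by
  have hn' : (n : ℂ) ≠ 0 := by exact_mod_cast hn.ne'
  set z := Complex.exp (2 * (Real.pi : ℂ) * Complex.I * x / n) with hz
  have hpow (k : ℕ) :
      Complex.exp (2 * (Real.pi : ℂ) * Complex.I * (k : ℂ) * (x : ℂ) / (n : ℂ)) = z ^ k := by
    rw [hz, ← Complex.exp_nat_mul]
    congr 1
    ring
  have hzn : Complex.exp (2 * (Real.pi : ℂ) * Complex.I * x) = z ^ n := by
    rw [← hpow]
    congr 1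
    field_simp
  have h1 : z ≠ 1 := by
    intro h
    obtain ⟨m, hm⟩ := Complex.exp_eq_one_iff.mp (hzn.trans (by rw [h, one_pow]))
    rw [mul_comm] at hm
    have := mul_right_cancel₀ Complex.two_pi_I_ne_zero hm
    exact hx m (by exact_mod_cast this)
  simp only [hpow]
  rw [hzn, neg_div, Complex.exp_neg, ← hz]
  exact geom_sum_Icc_eq_div_inv_sub_one (Complex.exp_ne_zero _) h1 n

/-- For every positive integer `q` and every real `x ∉ ℤ`,
`c_q(x) = (1 − e^{2πix})·∑_{d ∣ q} μ(q/d)/(e^{−2πix/d} − 1)`. -/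
theorem stmt8 (q : ℕ) (hq : 0 < q) (x : ℝ) (hx : ∀ n : ℤ, x ≠ n) :
    cq q x = (1 - Complex.exp (2 * (Real.pi : ℂ) * Complex.I * x)) *
      ∑ d ∈ q.divisors, (ArithmeticFunction.moebius (q / d) : ℂ) /
        (Complex.exp (-(2 * (Real.pi : ℂ) * Complex.I * x) / d) - 1) := by
  have h := (ArithmeticFunction.sum_eq_iff_sum_mul_moebius_eq (f := fun n => cq n x)).mp
    (fun n hn => (sum_divisors_cq x hn).trans (sum_exp_eq_div x hx hn)) q hq
  rw [← h, Nat.sum_divisorsAntidiagonal' (fun a b => (ArithmeticFunction.moebius a : ℂ) *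
    ((1 - Complex.exp (2 * (Real.pi : ℂ) * Complex.I * x)) /
      (Complex.exp (-(2 * (Real.pi : ℂ) * Complex.I * x) / b) - 1))), Finset.mul_sum]
  exact Finset.sum_congr rfl fun d _ => by ring
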